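/- There exist α₀ ∈ (0, 1/2) and B > 0 such that for every α ∈ (0, α₀), every nonnegative integer n, and every real-analytic solution (F, A, Z) on [0,1] of the boundary value problem of Theorem 1 (the CSS equations with boundary values F(0) = 0, Z(0) = 0, A(0) = 1, F(1) = π/2, Z(1) = 1, A(1) = 1 − 2α, and with F − π/2 having exactly n zeros in (0,1)), the derivative b = F′(1) satisfies |b| ≤ B. -/

import Mathlib

open Real Filter Set Topology

noncomputable section

/-- A real-analytic solution on `[0,1]` of the CSS boundary value problem of
Theorem 1, whose profile `F - π/2` has exactly `n` zeros in `(0,1)`. -/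
def Thm1Sol (α : ℝ) (n : ℕ) (F A Z : ℝ → ℝ) : Prop :=
  AnalyticOnNhd ℝ F (Set.Icc 0 1) ∧
  AnalyticOnNhd ℝ A (Set.Icc 0 1) ∧
  AnalyticOnNhd ℝ Z (Set.Icc 0 1) ∧
  (∀ ρ ∈ Set.Ioo (0:ℝ) 1,
    deriv (deriv F) ρ + (2 / ρ) * deriv F ρ
        - α * (1 + Z ρ ^ 2) * ρ * deriv F ρ ^ 3
        - Real.sin (2 * F ρ) / (A ρ * ρ ^ 2 * (1 - Z ρ ^ 2)) = 0 ∧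
    deriv A ρ = -2 * α * ρ * A ρ * deriv F ρ ^ 2 ∧
    ρ * deriv Z ρ = Z ρ * (1 + α * (1 - Z ρ ^ 2) * ρ ^ 2 * deriv F ρ ^ 2) ∧
    1 - A ρ - 2 * α * Real.sin (F ρ) ^ 2
        + α * A ρ * ρ ^ 2 * deriv F ρ ^ 2 * (1 - Z ρ ^ 2) = 0) ∧
  F 0 = 0 ∧ Z 0 = 0 ∧ A 0 = 1 ∧
  F 1 = π / 2 ∧ Z 1 = 1 ∧ A 1 = 1 - 2 * α ∧
  {ρ ∈ Set.Ioo (0:ℝ) 1 | F ρ = π / 2}.Finite ∧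
  {ρ ∈ Set.Ioo (0:ℝ) 1 | F ρ = π / 2}.ncard = n

/-- A continuous function with nonnegative derivative in the interior does not decrease. -/
theorem le_of_hasDerivAt_nonneg {f f' : ℝ → ℝ} {a b : ℝ} (hab : a ≤ b)
    (hc : ContinuousOn f (Icc a b)) (hd : ∀ x ∈ Ioo a b, HasDerivAt f (f' x) x)
    (h0 : ∀ x ∈ Ioo a b, 0 ≤ f' x) : f a ≤ f b := by
  refine monotoneOn_of_deriv_nonneg (convex_Icc a b) hc ?_ ?_ ⟨le_rfl, hab⟩ ⟨hab, le_rfl⟩ hab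
  · rw [interior_Icc]
    exact fun x hx => (hd x hx).differentiableAt.differentiableWithinAt
  · rw [interior_Icc]
    intro x hx
    rw [(hd x hx).deriv]
    exact h0 x hx

/-- If `|f'| ≤ g'` in the interior, the increment of `f` is dominated by that of `g`. -/
theorem abs_sub_le_of_hasDerivAt {f f' g g' : ℝ → ℝ} {a b : ℝ} (hab : a ≤ b)
    (hfc : ContinuousOn f (Icc a b)) (hf : ∀ x ∈ Ioo a b, HasDerivAt f (f' x) x)
    (hgc : ContinuousOn g (Icc a b)) (hg : ∀ x ∈ Ioo a b, HasDerivAt g (g' x) x)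
    (h : ∀ x ∈ Ioo a b, |f' x| ≤ g' x) : |f b - f a| ≤ g b - g a := by
  have h1 := le_of_hasDerivAt_nonneg hab (hgc.add hfc)
    (fun x hx => (hg x hx).add (hf x hx)) (fun x hx => by linarith [(abs_le.mp (h x hx)).1])
  have h2 := le_of_hasDerivAt_nonneg hab (hgc.sub hfc)
    (fun x hx => (hg x hx).sub (hf x hx)) (fun x hx => by linarith [(abs_le.mp (h x hx)).2])
  simp only [Pi.add_apply, Pi.sub_apply] at h1 h2
  rw [abs_le]
  constructor <;> linarith

namespace Thm1Sol

variable {α : ℝ} {n : ℕ} {F A Z : ℝ → ℝ}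

theorem hasDerivAt_A (h : Thm1Sol α n F A Z) {x : ℝ} (hx : x ∈ Ioo (0 : ℝ) 1) :
    HasDerivAt A (-2 * α * x * A x * deriv F x ^ 2) x := by
  obtain ⟨-, hA, -, hode, -⟩ := h
  rw [← (hode x hx).2.1]
  exact (hA x (Ioo_subset_Icc_self hx)).differentiableAt.hasDerivAt

theorem hasDerivAt_Z (h : Thm1Sol α n F A Z) {x : ℝ} (hx : x ∈ Ioo (0 : ℝ) 1) :
    HasDerivAt Z (Z x * (1 + α * (1 - Z x ^ 2) * x ^ 2 * deriv F x ^ 2) / x) x := by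
  obtain ⟨-, -, hZ, hode, -⟩ := h
  rw [← (hode x hx).2.2.1, mul_div_cancel_left₀ _ hx.1.ne']
  exact (hZ x (Ioo_subset_Icc_self hx)).differentiableAt.hasDerivAt

/-- By the constraint, `A` cannot vanish, so it keeps the sign it has at the origin. -/
theorem A_pos (h : Thm1Sol α n F A Z) (h0 : 0 < α) (h1 : α < 1 / 4) {x : ℝ}
    (hx : x ∈ Ioo (0 : ℝ) 1) : 0 < A x := by
  obtain ⟨-, hA, -, hode, -, -, hA0, -, -, -, -⟩ := h
  by_contra! hneg
  have hc : ContinuousOn A (Icc 0 x) :=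
    hA.continuousOn.mono (Icc_subset_Icc_right hx.2.le)
  obtain ⟨y, hy, hy0⟩ := intermediate_value_Icc' hx.1.le hc ⟨hneg, by rw [hA0]; norm_num⟩
  have hypos : 0 < y := lt_of_le_of_ne hy.1 (by rintro rfl; linarith)
  have hcon := (hode y ⟨hypos, hy.2.trans_lt hx.2⟩).2.2.2
  rw [hy0] at hcon
  nlinarith [Real.sin_sq_le_one (F y), sq_nonneg (Real.sin (F y))]

theorem A_mem (h : Thm1Sol α n F A Z) (h0 : 0 < α) (h1 : α < 1 / 4) {x : ℝ}
    (hx : x ∈ Ioo (0 : ℝ) 1) : A x ∈ Icc (1 - 2 * α) 1 := by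
  have hanti : ∀ a b : ℝ, 0 ≤ a → a ≤ b → b ≤ 1 → A b ≤ A a := by
    intro a b ha hab hb
    have hsub : Ioo a b ⊆ Ioo (0 : ℝ) 1 := Ioo_subset_Ioo ha hb
    have := le_of_hasDerivAt_nonneg hab
      (h.2.1.continuousOn.mono (Icc_subset_Icc ha hb)).neg
      (fun y hy => (h.hasDerivAt_A (hsub hy)).neg) (fun y hy => by
        have hA := h.A_pos h0 h1 (hsub hy)
        have hy0 := (hsub hy).1
        have : 0 ≤ 2 * α * y * A y * deriv F y ^ 2 := by positivity
        linarith)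
    simp only [Pi.neg_apply] at this
    linarith
  obtain ⟨-, -, -, -, -, -, hA0, -, -, hA1, -⟩ := h
  exact ⟨hA1 ▸ hanti x 1 hx.1.le hx.2.le le_rfl, hA0 ▸ hanti 0 x le_rfl hx.1.le hx.2.le⟩

theorem Z_sq_le_one (h : Thm1Sol α n F A Z) (h0 : 0 < α) (h1 : α < 1 / 4) {x : ℝ}
    (hx : x ∈ Ioo (0 : ℝ) 1) : Z x ^ 2 ≤ 1 := by
  have hsub : Ioo x 1 ⊆ Ioo (0 : ℝ) 1 := Ioo_subset_Ioo_left hx.1.le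
  have hmono := le_of_hasDerivAt_nonneg hx.2.le
    ((h.2.2.1.continuousOn.mono (Icc_subset_Icc_left hx.1.le)).pow 2)
    (fun y hy => (h.hasDerivAt_Z (hsub hy)).pow 2) (fun y hy => by
      have hA := h.A_pos h0 h1 (hsub hy)
      have hA2 := (h.A_mem h0 h1 (hsub hy)).1
      have hy0 := (hsub hy).1
      have hcon := (h.2.2.2.1 y (hsub hy)).2.2.2
      have key : 0 ≤ 1 + α * (1 - Z y ^ 2) * y ^ 2 * deriv F y ^ 2 := by
        refine nonneg_of_mul_nonneg_right (a := A y) ?_ hA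
        nlinarith [mul_nonneg h0.le (sq_nonneg (Real.sin (F y)))]
      have : 0 ≤ 2 * (Z y ^ 2 * (1 + α * (1 - Z y ^ 2) * y ^ 2 * deriv F y ^ 2) / y) := by
        positivity
      convert this using 1
      push_cast
      ring)
  obtain ⟨-, -, -, -, -, -, -, -, hZ1, -⟩ := h
  simpa [hZ1] using hmono

/-- The slope `Z/ρ` increases in absolute value, so `Z` lies below its flat profile. -/
theorem Z_sq_le_sq (h : Thm1Sol α n F A Z) (h0 : 0 < α) (h1 : α < 1 / 4) {x : ℝ}
    (hx : x ∈ Ioo (0 : ℝ) 1) : Z x ^ 2 ≤ x ^ 2 := by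
  have hsub : Ioo x 1 ⊆ Ioo (0 : ℝ) 1 := Ioo_subset_Ioo_left hx.1.le
  have hmono := le_of_hasDerivAt_nonneg (f := fun y => (Z y / y) ^ 2) hx.2.le
    (((h.2.2.1.continuousOn.mono (Icc_subset_Icc_left hx.1.le)).div continuousOn_id
      (fun y hy => (hx.1.trans_le hy.1).ne')).pow 2)
    (fun y hy => ((h.hasDerivAt_Z (hsub hy)).div (hasDerivAt_id y) (hsub hy).1.ne').pow 2)
    (fun y hy => by
      have hy0 := (hsub hy).1
      have hZ : 0 ≤ 1 - Z y ^ 2 := by linarith [h.Z_sq_le_one h0 h1 (hsub hy)]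
      have : 0 ≤ 2 * (Z y / y) ^ 2 * (α * (1 - Z y ^ 2) * y * deriv F y ^ 2) := by
        positivity
      convert this using 1
      simp only [id]
      push_cast
      field_simp
      simp only [Pi.div_apply, id]
      field_simp
      ring)
  obtain ⟨-, -, -, -, -, -, -, -, hZ1, -⟩ := h
  rw [hZ1, div_pow] at hmono
  have := (div_le_iff₀ (pow_pos hx.1 2)).mp hmono
  linarith

/-- Near the light cone the profile satisfies a Hölder bound of exponent `1/2`, since the total
variation of `A` controls the square integral of `F'`. -/
theorem abs_F_sub_le (h : Thm1Sol α n F A Z) (h0 : 0 < α) (h1 : α < 1 / 4) {x : ℝ}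
    (hx : x ∈ Ioo (1 / 2 : ℝ) 1) : |F x - π / 2| ≤ 2 * √(1 - x) := by
  have hx0 : (0 : ℝ) ≤ x := by linarith [hx.1]
  have hx' : x ∈ Ioo (0 : ℝ) 1 := ⟨by linarith [hx.1], hx.2⟩
  have hsub : Ioo x 1 ⊆ Ioo (0 : ℝ) 1 := Ioo_subset_Ioo_left hx0
  have hcsub : Icc x 1 ⊆ Icc (0 : ℝ) 1 := Icc_subset_Icc_left hx0
  set s := √(1 - x) with hs
  have hspos : 0 < s := Real.sqrt_pos.mpr (by linarith [hx.2])
  have hss : s ^ 2 = 1 - x := Real.sq_sqrt (by linarith [hx.2])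
  have key := abs_sub_le_of_hasDerivAt (f := F) (g := fun y => y / s - s / (2 * α) * A y)
    hx.2.le (h.1.continuousOn.mono hcsub)
    (fun y hy => (h.1 y (Ioo_subset_Icc_self (hsub hy))).differentiableAt.hasDerivAt)
    (((continuousOn_id).div_const s).sub
      (continuousOn_const.mul (h.2.1.continuousOn.mono hcsub)))
    (fun y hy => ((hasDerivAt_id y).div_const s).sub
      ((h.hasDerivAt_A (hsub hy)).const_mul (s / (2 * α))))
    (fun y hy => by
      have hA := (h.A_mem h0 h1 (hsub hy)).1
      have hyA : 1 / 4 ≤ y * A y := by nlinarith [hx.1, hy.1]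
      have e : 1 / s - s / (2 * α) * (-2 * α * y * A y * deriv F y ^ 2)
          = (1 + s ^ 2 * (y * A y) * deriv F y ^ 2) / s := by
        field_simp
        ring
      rw [e, le_div_iff₀ hspos]
      have h4 : s ^ 2 * (1 / 4) * |deriv F y| ^ 2 ≤ s ^ 2 * (y * A y) * |deriv F y| ^ 2 := by
        gcongr
      rw [sq_abs (deriv F y)] at h4
      nlinarith [sq_nonneg (s * |deriv F y| / 2 - 1), sq_abs (deriv F y)])
  have hAx := (h.A_mem h0 h1 hx').2
  obtain ⟨-, -, -, -, -, -, -, hF1, -, hA1, -⟩ := h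
  rw [hF1, hA1, abs_sub_comm] at key
  refine key.trans ?_
  have e1 : 1 / s - x / s = s := by
    rw [← sub_div, ← hss]
    field_simp
  have e2 : s / (2 * α) * (A x - (1 - 2 * α)) ≤ s := by
    have : s / (2 * α) * (A x - (1 - 2 * α)) ≤ s / (2 * α) * (2 * α) := by
      gcongr
      linarith
    rwa [div_mul_cancel₀ _ (by positivity)] at this
  linarith

/-- `ρ A Z` is an integrating factor for the equation of `F`. -/
theorem hasDerivAt_flux (h : Thm1Sol α n F A Z) (h0 : 0 < α) (h1 : α < 1 / 4) {x : ℝ}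
    (hx : x ∈ Ioo (0 : ℝ) 1) :
    HasDerivAt (fun y => y * A y * Z y * deriv F y)
      (Z x * Real.sin (2 * F x) / (x * (1 - Z x ^ 2))) x := by
  have hA := h.A_pos h0 h1 hx
  have hx0 := hx.1
  have hZ : 0 < 1 - Z x ^ 2 := by nlinarith [h.Z_sq_le_sq h0 h1 hx, hx.1, hx.2]
  have hF := (h.1 x (Ioo_subset_Icc_self hx)).deriv.differentiableAt.hasDerivAt
  have hode := (h.2.2.2.1 x hx).1
  have hF2 : deriv (deriv F) x = -(2 / x) * deriv F x
      + α * (1 + Z x ^ 2) * x * deriv F x ^ 3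
      + Real.sin (2 * F x) / (A x * x ^ 2 * (1 - Z x ^ 2)) := by linarith
  refine ((((hasDerivAt_id x).mul (h.hasDerivAt_A hx)).mul (h.hasDerivAt_Z hx)).mul
    hF).congr_deriv ?_
  rw [hF2]
  simp only [Pi.mul_apply, id]
  field_simp
  ring

theorem abs_flux_deriv_le (h : Thm1Sol α n F A Z) (h0 : 0 < α) (h1 : α < 1 / 4) {x : ℝ}
    (hx : x ∈ Ioo (1 / 2 : ℝ) 1) :
    |Z x * Real.sin (2 * F x) / (x * (1 - Z x ^ 2))| ≤ 8 / √(1 - x) := by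
  have hx' : x ∈ Ioo (0 : ℝ) 1 := ⟨by linarith [hx.1], hx.2⟩
  have hF := h.abs_F_sub_le h0 h1 hx
  have hZ := h.Z_sq_le_sq h0 h1 hx'
  set s := √(1 - x) with hs
  have hspos : 0 < s := Real.sqrt_pos.mpr (by linarith [hx.2])
  have hss : s ^ 2 = 1 - x := Real.sq_sqrt (by linarith [hx.2])
  have hsin : |Real.sin (2 * F x)| ≤ 4 * s := by
    have e : Real.sin (2 * F x) = -Real.sin (2 * (F x - π / 2)) := by
      rw [show 2 * (F x - π / 2) = 2 * F x - π by ring, Real.sin_sub_pi, neg_neg]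
    rw [e, abs_neg]
    refine Real.abs_sin_le_abs.trans ?_
    rw [abs_mul, abs_two]
    linarith
  have hZ1 : |Z x| ≤ 1 := (sq_le_one_iff_abs_le_one _).mp (by nlinarith [hx.1, hx.2])
  have hden : s ^ 2 / 2 ≤ x * (1 - Z x ^ 2) := by nlinarith [hx.1, hx.2]
  have hdpos : 0 < x * (1 - Z x ^ 2) := lt_of_lt_of_le (by positivity) hden
  rw [abs_div, abs_mul, abs_of_pos hdpos, div_le_div_iff₀ hdpos hspos]
  have hnum : |Z x| * |Real.sin (2 * F x)| ≤ 1 * (4 * s) := by gcongr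
  nlinarith [mul_le_mul_of_nonneg_right hnum hspos.le]

theorem abs_flux_sub_le (h : Thm1Sol α n F A Z) (h0 : 0 < α) (h1 : α < 1 / 4) {x : ℝ}
    (hx : x ∈ Ioo (1 / 2 : ℝ) 1) :
    |(1 - 2 * α) * deriv F 1 - x * A x * Z x * deriv F x| ≤ 16 := by
  have hx0 : (0 : ℝ) ≤ x := by linarith [hx.1]
  have hsub : Ioo x 1 ⊆ Ioo (0 : ℝ) 1 := Ioo_subset_Ioo_left hx0
  have hcsub : Icc x 1 ⊆ Icc (0 : ℝ) 1 := Icc_subset_Icc_left hx0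
  have key := abs_sub_le_of_hasDerivAt (g := fun y => -(16 * √(1 - y)))
    (g' := fun y => 8 / √(1 - y)) hx.2.le
    (((continuousOn_id.mul h.2.1.continuousOn).mul h.2.2.1.continuousOn).mul
      h.1.deriv.continuousOn |>.mono hcsub)
    (fun y hy => h.hasDerivAt_flux h0 h1 (hsub hy))
    (by fun_prop)
    (fun y hy => by
      have hy1 : 0 < 1 - y := by linarith [hy.2]
      refine (((((hasDerivAt_id y).const_sub 1).sqrt hy1.ne').const_mul 16).neg).congr_deriv ?_
      have := Real.sqrt_pos.mpr hy1
      simp only [id]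
      field_simp
      norm_num)
    (fun y hy => h.abs_flux_deriv_le h0 h1 ⟨hx.1.trans hy.1, hy.2⟩)
  obtain ⟨-, -, -, -, -, -, -, -, hZ1, hA1, -⟩ := h
  have hs : √(1 - x) ≤ 1 := Real.sqrt_le_one.mpr (by linarith)
  simp only [Pi.mul_apply, id, hZ1, hA1, sub_self, Real.sqrt_zero, one_mul, mul_one,
    mul_zero, neg_zero] at key
  linarith

/-- The mean value theorem for `A` yields a point near the light cone where `F'` is bounded. -/
theorem exists_deriv_sq_le (h : Thm1Sol α n F A Z) (h0 : 0 < α) (h1 : α < 1 / 4) :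
    ∃ x ∈ Ioo (1 / 2 : ℝ) 1, deriv F x ^ 2 ≤ 8 := by
  have hsub : Ioo (1 / 2 : ℝ) 1 ⊆ Ioo (0 : ℝ) 1 := Ioo_subset_Ioo_left (by norm_num)
  obtain ⟨x, hx, hslope⟩ := exists_hasDerivAt_eq_slope A _ (by norm_num : (1 / 2 : ℝ) < 1)
    (h.2.1.continuousOn.mono (Icc_subset_Icc_left (by norm_num)))
    (fun y hy => h.hasDerivAt_A (hsub hy))
  refine ⟨x, hx, ?_⟩
  have hA := (h.A_mem h0 h1 (hsub hx)).1
  have hA2 := (h.A_mem h0 h1 (x := 1 / 2) ⟨by norm_num, by norm_num⟩).2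
  obtain ⟨-, -, -, -, -, -, -, -, -, hA1, -⟩ := h
  rw [hA1, eq_div_iff (by norm_num)] at hslope
  have hxA : 1 / 4 ≤ x * A x := by nlinarith [hx.1]
  have hupper : α * (x * A x * deriv F x ^ 2) ≤ α * 2 := by linarith
  have hle := le_of_mul_le_mul_left hupper h0
  nlinarith [mul_le_mul_of_nonneg_right hxA (sq_nonneg (deriv F x))]

theorem abs_deriv_one_le (h : Thm1Sol α n F A Z) (h0 : 0 < α) (h1 : α < 1 / 4) :
    |deriv F 1| ≤ 38 := by
  obtain ⟨x, hx, hFx⟩ := h.exists_deriv_sq_le h0 h1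
  have hx' : x ∈ Ioo (0 : ℝ) 1 := ⟨by linarith [hx.1], hx.2⟩
  have hflux := h.abs_flux_sub_le h0 h1 hx
  have hA := h.A_pos h0 h1 hx'
  have hA1 := (h.A_mem h0 h1 hx').2
  have hZ : |Z x| ≤ 1 := (sq_le_one_iff_abs_le_one _).mp (h.Z_sq_le_one h0 h1 hx')
  have hF : |deriv F x| ≤ 3 := abs_le_of_sq_le_sq (by linarith) (by norm_num)
  have hbound : |x * A x * Z x * deriv F x| ≤ 1 * 1 * 1 * 3 := by
    rw [abs_mul, abs_mul, abs_mul, abs_of_pos hx'.1, abs_of_pos hA]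
    have := hx'.1
    have := hx'.2.le
    gcongr
  have htri := abs_sub_abs_le_abs_sub ((1 - 2 * α) * deriv F 1) (x * A x * Z x * deriv F x)
  rw [abs_mul, abs_of_pos (by linarith : (0 : ℝ) < 1 - 2 * α)] at htri
  nlinarith [abs_nonneg (deriv F 1)]

end Thm1Sol

/-- Lemma 10: there are `α₀ ∈ (0,1/2)` and `B > 0` such that for all
`α ∈ (0, α₀)`, every solution of the boundary value problem of Theorem 1 (for
any nodal index `n`) has `|b| = |F'(1)| ≤ B`. -/
theorem lemma10 :
    ∃ α₀ : ℝ, 0 < α₀ ∧ α₀ < 1 / 2 ∧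
      ∃ B > (0:ℝ), ∀ α, 0 < α → α < α₀ → ∀ (n : ℕ) (F A Z : ℝ → ℝ),
        Thm1Sol α n F A Z → |deriv F 1| ≤ B := by
  exact ⟨1 / 4, by norm_num, by norm_num, 38, by norm_num,
    fun _ h0 h1 _ _ _ _ h => h.abs_deriv_one_le h0 h1⟩
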